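/- Let N_13 be the 4-dimensional ℂ-algebra with basis e_1,e_2,e_3,e_4 and only nonzero basis products e_1e_1 = e_4, e_1e_2 = e_3, e_2e_1 = −e_3, e_2e_2 = 2e_3 + e_4. Each of the six bilinear forms Δ₂₁, Δ₂₂, Δ₁₄+Δ₂₃, Δ₁₃−2Δ₁₄−Δ₂₄, Δ₃₂−Δ₄₁, Δ₃₁−2Δ₃₂+Δ₄₂ is a cocycle on N_13, and their cosets modulo B²(N_13,ℂ) form a basis of H²(N_13,ℂ); in particular dim H²(N_13,ℂ) = 6. -/

import Mathlib

/-- The elementary bilinear multiplication on `ℂ^n` sending `(x, y)` to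
`(x_i * y_j) • e_k`; the concrete algebra below is a sum of such terms. -/
noncomputable def T {n : ℕ} (i j k : Fin n) :
    (Fin n → ℂ) →ₗ[ℂ] (Fin n → ℂ) →ₗ[ℂ] (Fin n → ℂ) :=
  LinearMap.mk₂ ℂ (fun x y => (x i * y j) • (Pi.single k 1 : Fin n → ℂ))
    (fun x x' y => by simp [add_mul, add_smul])
    (fun c x y => by simp [smul_eq_mul, smul_smul, mul_assoc])
    (fun x y y' => by simp [mul_add, add_smul])
    (fun c x y => by simp [smul_eq_mul, smul_smul, mul_left_comm])

/-- The bilinear form `Δ_{ij}` on `ℂ^n` (0-indexed): `Δ_{ij}(x,y) = x_i y_j`,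
so that `Δ_{ij}(e_l, e_m) = δ_{il} δ_{jm}`. -/
noncomputable def D {n : ℕ} (i j : Fin n) :
    (Fin n → ℂ) →ₗ[ℂ] (Fin n → ℂ) →ₗ[ℂ] ℂ :=
  LinearMap.mk₂ ℂ (fun x y => x i * y j)
    (fun x x' y => by simp [add_mul])
    (fun c x y => by simp [mul_assoc])
    (fun x y y' => by simp [mul_add])
    (fun c x y => by simp [smul_eq_mul, mul_left_comm])

/-- The cocycle condition: `θ(xy,z) = θ(xz,y)` and `θ(x,yz) = θ(y,xz)`. -/
def IsCocycle {A V : Type*} [AddCommGroup A] [Module ℂ A] [AddCommGroup V] [Module ℂ V]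
    (m : A →ₗ[ℂ] A →ₗ[ℂ] A) (θ : A →ₗ[ℂ] A →ₗ[ℂ] V) : Prop :=
  (∀ x y z : A, θ (m x y) z = θ (m x z) y) ∧ (∀ x y z : A, θ x (m y z) = θ y (m x z))

/-- `Z²(A,ℂ)`: the space of scalar-valued cocycles. -/
noncomputable def Zsub {A : Type*} [AddCommGroup A] [Module ℂ A]
    (m : A →ₗ[ℂ] A →ₗ[ℂ] A) : Submodule ℂ (A →ₗ[ℂ] A →ₗ[ℂ] ℂ) where
  carrier := {θ | IsCocycle m θ}
  add_mem' := by
    rintro θ η ⟨h1, h2⟩ ⟨g1, g2⟩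
    refine ⟨fun x y z => ?_, fun x y z => ?_⟩
    · simp only [LinearMap.add_apply]
      rw [h1 x y z, g1 x y z]
    · simp only [LinearMap.add_apply]
      rw [h2 x y z, g2 x y z]
  zero_mem' := ⟨fun x y z => by simp, fun x y z => by simp⟩
  smul_mem' := by
    rintro c θ ⟨h1, h2⟩
    refine ⟨fun x y z => ?_, fun x y z => ?_⟩
    · simp only [LinearMap.smul_apply]
      rw [h1 x y z]
    · simp only [LinearMap.smul_apply]
      rw [h2 x y z]

/-- The coboundary map `f ↦ δf = ((x,y) ↦ f(xy))`. -/
noncomputable def cobound {A : Type*} [AddCommGroup A] [Module ℂ A]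
    (m : A →ₗ[ℂ] A →ₗ[ℂ] A) : (A →ₗ[ℂ] ℂ) →ₗ[ℂ] (A →ₗ[ℂ] A →ₗ[ℂ] ℂ) where
  toFun f := m.compr₂ f
  map_add' f g := by ext x y; simp [LinearMap.compr₂_apply]
  map_smul' c f := by ext x y; simp [LinearMap.compr₂_apply]

/-- `B²(A,ℂ)`: the space of scalar-valued coboundaries. -/
noncomputable def Bsub {A : Type*} [AddCommGroup A] [Module ℂ A]
    (m : A →ₗ[ℂ] A →ₗ[ℂ] A) : Submodule ℂ (A →ₗ[ℂ] A →ₗ[ℂ] ℂ) :=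
  LinearMap.range (cobound m)

/-- The coset of a bilinear form modulo `B²(A,ℂ)`. -/
noncomputable def cls {A : Type*} [AddCommGroup A] [Module ℂ A]
    (m : A →ₗ[ℂ] A →ₗ[ℂ] A) (θ : A →ₗ[ℂ] A →ₗ[ℂ] ℂ) :
    (A →ₗ[ℂ] A →ₗ[ℂ] ℂ) ⧸ Bsub m :=
  (Bsub m).mkQ θ

/-- `H²(A,ℂ) = Z²(A,ℂ)/B²(A,ℂ)`, realized as the image of the cocycles in the
quotient of the space of all bilinear forms by the coboundaries. -/
noncomputable def H2 {A : Type*} [AddCommGroup A] [Module ℂ A]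
    (m : A →ₗ[ℂ] A →ₗ[ℂ] A) : Submodule ℂ ((A →ₗ[ℂ] A →ₗ[ℂ] ℂ) ⧸ Bsub m) :=
  (Zsub m).map (Bsub m).mkQ

/-- The algebra `N_13` on `ℂ^4`: `e_1 e_1 = e_4`, `e_1 e_2 = e_3`, `e_2 e_1 = -e_3`, `e_2 e_2 = 2e_3 + e_4`. -/
noncomputable def mul : (Fin 4 → ℂ) →ₗ[ℂ] (Fin 4 → ℂ) →ₗ[ℂ] (Fin 4 → ℂ) :=
  T 0 0 3 + T 0 1 2 - T 1 0 2 + (2 : ℂ) • T 1 1 2 + T 1 1 3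

/-- The forms `Δ₂₁, Δ₂₂, Δ₁₄+Δ₂₃, Δ₁₃−2Δ₁₄−Δ₂₄, Δ₃₂−Δ₄₁, Δ₃₁−2Δ₃₂+Δ₄₂` (0-indexed). -/
noncomputable def forms : Fin 6 → ((Fin 4 → ℂ) →ₗ[ℂ] (Fin 4 → ℂ) →ₗ[ℂ] ℂ) :=
  ![D 1 0, D 1 1, D 0 3 + D 1 2, D 0 2 - (2 : ℂ) • D 0 3 - D 1 3, D 2 1 - D 3 0,
    D 2 0 - (2 : ℂ) • D 2 1 + D 3 1]

theorem D_apply {n : ℕ} (i j : Fin n) (x y : Fin n → ℂ) : D i j x y = x i * y j := rfl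

theorem N13_mul_apply (x y : Fin 4 → ℂ) :
    mul x y = ![0, 0, x 0 * y 1 - x 1 * y 0 + 2 * (x 1 * y 1), x 0 * y 0 + x 1 * y 1] := by
  ext k
  fin_cases k <;> simp [mul, T]

theorem sum_smul_forms_apply (g : Fin 6 → ℂ) (x y : Fin 4 → ℂ) :
    (∑ i, g i • forms i) x y =
      g 0 * (x 1 * y 0) + g 1 * (x 1 * y 1) + g 2 * (x 0 * y 3 + x 1 * y 2) +
      g 3 * (x 0 * y 2 - 2 * (x 0 * y 3) - x 1 * y 3) + g 4 * (x 2 * y 1 - x 3 * y 0) +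
      g 5 * (x 2 * y 0 - 2 * (x 2 * y 1) + x 3 * y 1) := by
  simp [forms, Fin.sum_univ_succ, D_apply]
  ring

theorem isCocycle_forms (i : Fin 6) : IsCocycle mul (forms i) := by
  constructor <;> intro x y z <;> fin_cases i <;>
    simp [forms, D_apply, N13_mul_apply] <;> ring

theorem apply_eq_sum_single (f : (Fin 4 → ℂ) →ₗ[ℂ] ℂ) (v : Fin 4 → ℂ) :
    f v = ∑ k, v k * f (Pi.single k 1) := by
  conv_lhs => rw [pi_eq_sum_univ' v]
  simp [map_sum]

theorem cobound_mul_apply (f : (Fin 4 → ℂ) →ₗ[ℂ] ℂ) (x y : Fin 4 → ℂ) :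
    cobound mul f x y =
      (x 0 * y 1 - x 1 * y 0 + 2 * (x 1 * y 1)) * f (Pi.single 2 1) +
      (x 0 * y 0 + x 1 * y 1) * f (Pi.single 3 1) := by
  change f (mul x y) = _
  rw [apply_eq_sum_single, N13_mul_apply]
  simp [Fin.sum_univ_four]

theorem sum_smul_cls (g : Fin 6 → ℂ) :
    ∑ i, g i • cls mul (forms i) = cls mul (∑ i, g i • forms i) := by
  simp only [cls, map_sum, map_smul]

theorem linearIndependent_cls_forms : LinearIndependent ℂ (fun i => cls mul (forms i)) := by
  rw [Fintype.linearIndependent_iff]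
  intro g hg
  rw [sum_smul_cls, cls, Submodule.mkQ_apply, Submodule.Quotient.mk_eq_zero] at hg
  obtain ⟨f, hf⟩ := hg
  have key (a b : Fin 4) := (LinearMap.congr_fun₂ hf (Pi.single a 1) (Pi.single b 1)).symm
  simp only [sum_smul_forms_apply, cobound_mul_apply] at key
  have h00 := key 0 0
  have h01 := key 0 1
  have h10 := key 1 0
  have h11 := key 1 1
  have h12 := key 1 2
  have h02 := key 0 2
  have h21 := key 2 1
  have h20 := key 2 0
  simp at h00 h01 h10 h11 h12 h02 h21 h20
  intro i
  fin_cases i <;> simp <;> grind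

theorem IsCocycle.exists_eq_add_cobound {θ : (Fin 4 → ℂ) →ₗ[ℂ] (Fin 4 → ℂ) →ₗ[ℂ] ℂ}
    (h : IsCocycle mul θ) :
    ∃ (g : Fin 6 → ℂ) (f : (Fin 4 → ℂ) →ₗ[ℂ] ℂ), θ = ∑ i, g i • forms i + cobound mul f := by
  obtain ⟨hl, hr⟩ := h
  set a : Fin 4 → Fin 4 → ℂ := fun i j => θ (Pi.single i 1) (Pi.single j 1) with ha
  have hθ (x y : Fin 4 → ℂ) : θ x y = ∑ i, ∑ j, x i * y j * a i j := by
    have := apply_eq_sum_single (θ.flip y) x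
    simp only [LinearMap.flip_apply] at this
    rw [this]
    refine Finset.sum_congr rfl fun i _ => ?_
    rw [apply_eq_sum_single, Finset.mul_sum]
    simp only [ha, mul_assoc]
  have l (i j k : Fin 4) := hl (Pi.single i 1) (Pi.single j 1) (Pi.single k 1)
  have r (i j k : Fin 4) := hr (Pi.single i 1) (Pi.single j 1) (Pi.single k 1)
  simp only [hθ, N13_mul_apply, Fin.sum_univ_four] at l r
  have l1 := l 0 0 1
  have l2 := l 1 0 1
  have l3 := l 0 0 2
  have l4 := l 0 1 2
  have l5 := l 0 0 3
  have l6 := l 0 1 3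
  have r1 := r 0 1 0
  have r2 := r 0 1 1
  simp at l1 l2 l3 l4 l5 l6 r1 r2
  refine ⟨![a 1 0 + a 0 1, a 1 1 - 2 * a 0 1 - a 0 0, a 1 2, a 0 2, a 2 1 + 2 * a 2 0, a 2 0],
    a 0 1 • LinearMap.proj 2 + a 0 0 • LinearMap.proj 3, ?_⟩
  refine LinearMap.ext₂ fun x y => ?_
  rw [hθ, LinearMap.add_apply, LinearMap.add_apply, sum_smul_forms_apply, cobound_mul_apply]
  simp [Fin.sum_univ_four]
  grind

theorem span_cls_forms :
    Submodule.span ℂ (Set.range fun i => cls mul (forms i)) = H2 mul := by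
  apply le_antisymm
  · rw [Submodule.span_le]
    rintro _ ⟨i, rfl⟩
    exact ⟨forms i, isCocycle_forms i, rfl⟩
  · rintro _ ⟨θ, hθ, rfl⟩
    obtain ⟨g, f, rfl⟩ := IsCocycle.exists_eq_add_cobound hθ
    have hf : (Bsub mul).mkQ (cobound mul f) = 0 := by
      rw [Submodule.mkQ_apply, Submodule.Quotient.mk_eq_zero]
      exact ⟨f, rfl⟩
    rw [map_add, hf, add_zero]
    change cls mul _ ∈ _
    rw [← sum_smul_cls]
    exact Submodule.sum_mem _ fun i _ =>
      Submodule.smul_mem _ _ (Submodule.subset_span ⟨i, rfl⟩)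


/-- The listed forms are cocycles, their cosets modulo `B²` form a basis of `H²`,
and in particular `dim H² = 6`. -/
theorem secondCohomology_N13 :
    (∀ i, IsCocycle mul (forms i)) ∧
    LinearIndependent ℂ (fun i => cls mul (forms i)) ∧
    Submodule.span ℂ (Set.range fun i => cls mul (forms i)) = H2 mul ∧
    Module.finrank ℂ (H2 mul) = 6 := by
  refine ⟨isCocycle_forms, linearIndependent_cls_forms, span_cls_forms, ?_⟩
  rw [← span_cls_forms, finrank_span_eq_card linearIndependent_cls_forms, Fintype.card_fin]
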